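/- arXiv:2104.14179 — 3 statements merged into one kernel-verified Lean document; each statement's English description precedes it below -/
import Mathlib

section
/- For every q ∈ [1,2) there exists a constant c₁ = c₁(q) > 0 such that for all ρ ∈ C¹_c(ℝ²) one has the estimate ‖∇U_ρ‖_{L^∞(ℝ²)} ≤ c₁ ‖ρ‖_{L^q(ℝ²)}^{q/2} ‖ρ‖_{L^∞(ℝ²)}^{1−q/2}. -/
open MeasureTheory Real

noncomputable section

abbrev E2 : Type := EuclideanSpace ℝ (Fin 2)

/-- The logarithmic (Newtonian) potential in two dimensions,
`U_ρ(x) = -2 ∫ ρ(y) ln|x-y| dy`. -/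
def Upot (ρ : E2 → ℝ) (x : E2) : ℝ := -2 * ∫ y : E2, ρ y * Real.log ‖x - y‖

def kern (s t : ℝ) : ℝ := t⁻¹ * (1 + t) ^ (-s)

lemma kern_int (s : ℝ) (hs : 1 < s) : Integrable (fun z : E2 => kern s ‖z‖) := by
  rw [integrable_fun_norm_addHaar volume (f := kern s)]
  have h : IntegrableOn (fun y : ℝ => (1 + y) ^ (-s)) (Set.Ioi 0) := by
    have := (integrable_one_add_norm (E := ℝ) (μ := volume) (r := s) (by simpa using hs)).integrableOn (s := Set.Ioi (0:ℝ))
    refine this.congr_fun ?_ measurableSet_Ioi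
    intro y hy
    have hy : 0 < y := hy
    simp [abs_of_pos hy]
  refine h.congr_fun ?_ measurableSet_Ioi
  intro y hy
  have hy : 0 < y := hy
  simp [kern]
  field_simp

lemma kern_scale (s R : ℝ) (hs : 1 < s) (hR : 0 < R) (x : E2) :
    Integrable (fun y : E2 => kern s (‖x - y‖ / R)) ∧
    ∫ y : E2, kern s (‖x - y‖ / R) = R ^ 2 * ∫ z : E2, kern s ‖z‖ := by
  have e : ∀ z : E2, kern s (‖z‖ / R) = kern s ‖R⁻¹ • z‖ := by
    intro z
    rw [norm_smul, Real.norm_of_nonneg (inv_nonneg.2 hR.le), div_eq_inv_mul]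
  have h1 : Integrable (fun y : E2 => kern s (‖y‖ / R)) := by
    simp_rw [e]
    exact (kern_int s hs).comp_smul (inv_ne_zero hR.ne')
  refine ⟨h1.comp_sub_left x, ?_⟩
  rw [integral_sub_left_eq_self (fun y : E2 => kern s (‖y‖ / R)) volume x]
  simp_rw [e]
  rw [Measure.integral_comp_smul volume (fun z : E2 => kern s ‖z‖)]
  simp

lemma ptwise (q M a r R : ℝ) (hq1 : 1 ≤ q) (hq2 : q < 2) (hM : 0 < M) (ha : 0 ≤ a) (haM : a ≤ M)
    (hr : 0 ≤ r) (hR : 0 < R) :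
    a * r⁻¹ ≤ (2:ℝ) ^ (2/q) * M / R * kern (2/q) (r / R) + a ^ q * (M ^ (1 - q) / R) := by
  rcases hr.eq_or_lt with h0 | hr
  · subst h0
    simp [kern]; positivity
  obtain ⟨t, ht⟩ : ∃ t, t = r / R := ⟨_, rfl⟩
  have htp : 0 < t := by rw [ht]; positivity
  have hrt : r = t * R := by rw [ht]; field_simp
  rw [← ht]
  have hnn : 0 ≤ a ^ q * (M ^ (1 - q) / R) := by positivity
  have hkn : 0 ≤ (2:ℝ) ^ (2/q) * M / R * kern (2/q) t := by unfold kern; positivity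
  by_cases hc : a ≤ M * (2 / (1 + t)) ^ (2/q)
  · refine le_trans ?_ (le_add_of_nonneg_right hnn)
    calc a * r⁻¹ ≤ (M * (2 / (1 + t)) ^ (2/q)) * r⁻¹ := by gcongr
      _ = _ := by
        unfold kern
        rw [Real.div_rpow (by norm_num) (by positivity), Real.rpow_neg (by positivity), hrt]
        field_simp
  · push Not at hc
    refine le_trans ?_ (le_add_of_nonneg_left hkn)
    have ht1 : 1 < t := by
      by_contra h
      push Not at h
      have : 1 ≤ (2 / (1 + t)) ^ (2/q) := by
        apply Real.one_le_rpow _ (by positivity)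
        rw [le_div_iff₀ (by positivity)]; linarith
      nlinarith
    have hap : 0 < a := lt_of_le_of_lt (by positivity) hc
    have h1 : a ^ (1 - q) ≤ M ^ (1 - q) * t := by
      calc a ^ (1 - q) ≤ (M * (2 / (1 + t)) ^ (2/q)) ^ (1 - q) :=
            Real.rpow_le_rpow_of_nonpos (by positivity) hc.le (by linarith)
        _ = M ^ (1 - q) * ((1 + t) / 2) ^ (2 / q * (q - 1)) := by
            rw [Real.mul_rpow hM.le (by positivity), ← Real.rpow_mul (by positivity)]
            congr 1
            rw [show (1 + t) / 2 = (2 / (1 + t))⁻¹ by rw [inv_div], Real.inv_rpow (by positivity),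
              ← Real.rpow_neg (by positivity)]
            congr 1; ring
        _ ≤ M ^ (1 - q) * t := by
            gcongr
            calc ((1 + t) / 2) ^ (2 / q * (q - 1)) ≤ ((1 + t) / 2) ^ (1:ℝ) := by
                  apply Real.rpow_le_rpow_of_exponent_le (by linarith)
                  rw [div_mul_eq_mul_div, div_le_one (by linarith)]; linarith
              _ ≤ t := by rw [Real.rpow_one]; linarith
    have h2 : a = a ^ q * a ^ (1 - q) := by
      rw [← Real.rpow_add hap]; simp
    calc a * r⁻¹ = a ^ q * a ^ (1 - q) * r⁻¹ := by rw [← h2]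
      _ ≤ a ^ q * (M ^ (1 - q) * t) * r⁻¹ := by gcongr
      _ = _ := by rw [hrt]; field_simp

lemma I_bound (q : ℝ) (hq1 : 1 ≤ q) (hq2 : q < 2) (ρ : E2 → ℝ) (hc : Continuous ρ)
    (hs : HasCompactSupport ρ) (x : E2) :
    Integrable (fun y : E2 => |ρ y| * ‖x - y‖⁻¹) ∧
    ∫ y : E2, |ρ y| * ‖x - y‖⁻¹ ≤ ((2:ℝ) ^ (2/q) * (∫ z : E2, kern (2/q) ‖z‖) + 1) *
      (∫ y : E2, |ρ y| ^ q) ^ ((1:ℝ)/2) * (⨆ y : E2, |ρ y|) ^ (1 - q/2) := by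
  have hs1 : 1 < 2 / q := by rw [lt_div_iff₀ (by linarith)]; linarith
  have hK : 0 ≤ ∫ z : E2, kern (2/q) ‖z‖ := integral_nonneg fun z => by
    simp only [kern, Pi.zero_apply]; positivity
  have hN0 : 0 ≤ ∫ y : E2, |ρ y| ^ q := integral_nonneg fun z => by
    simp only [Pi.zero_apply]; positivity
  have hbdd : BddAbove (Set.range fun y : E2 => |ρ y|) := by
    have := hs.norm.isCompact_range hc.norm
    exact this.bddAbove
  have hle : ∀ y, |ρ y| ≤ ⨆ y : E2, |ρ y| := fun y => le_ciSup hbdd y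
  have hM0 : 0 ≤ ⨆ y : E2, |ρ y| := (abs_nonneg _).trans (hle 0)
  by_cases hz : ∀ y, ρ y = 0
  · simp only [hz, abs_zero, zero_mul, integral_zero]
    refine ⟨integrable_zero _ _ _, ?_⟩
    simp only [hz, abs_zero] at hM0 hN0
    positivity
  push Not at hz
  obtain ⟨y0, hy0⟩ := hz
  set M := ⨆ y : E2, |ρ y| with hMdef
  have hM : 0 < M := lt_of_lt_of_le (abs_pos.2 hy0) (hle y0)
  have hcq : Continuous fun y => |ρ y| ^ q :=
    hc.abs.rpow_const fun y => Or.inr (by linarith)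
  have hsq : HasCompactSupport fun y => |ρ y| ^ q :=
    hs.comp_left (g := fun a : ℝ => |a| ^ q) (by simp; exact Real.zero_rpow (by linarith))
  have hintq : Integrable fun y => |ρ y| ^ q := hcq.integrable_of_hasCompactSupport hsq
  set N := ∫ y : E2, |ρ y| ^ q with hNdef
  have hN : 0 < N := by
    apply hcq.integral_pos_of_hasCompactSupport_nonneg_nonzero hsq (x := y0)
    · intro y; simp only [Pi.zero_apply]; positivity
    · exact (Real.rpow_pos_of_pos (abs_pos.2 hy0) _).ne'
  set R := N ^ ((1:ℝ)/2) * M ^ (-q/2) with hRdef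
  have hR : 0 < R := by positivity
  obtain ⟨hk1, hk2⟩ := kern_scale (2/q) R hs1 hR x
  have hpt : ∀ y, |ρ y| * ‖x - y‖⁻¹ ≤ (2:ℝ) ^ (2/q) * M / R * kern (2/q) (‖x - y‖ / R) + |ρ y| ^ q * (M ^ (1 - q) / R) :=
    fun y => ptwise q M _ _ R hq1 hq2 hM (abs_nonneg _) (hle y) (norm_nonneg _) hR
  have hint : Integrable fun y => (2:ℝ) ^ (2/q) * M / R * kern (2/q) (‖x - y‖ / R) + |ρ y| ^ q * (M ^ (1 - q) / R) :=
    (hk1.const_mul _).add (hintq.mul_const _)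
  have hI : Integrable (fun y : E2 => |ρ y| * ‖x - y‖⁻¹) := by
    refine hint.mono' ?_ (Filter.Eventually.of_forall fun y => ?_)
    · exact (hc.measurable.abs.mul (by fun_prop)).aestronglyMeasurable
    · rw [Real.norm_of_nonneg (by positivity)]; exact hpt y
  refine ⟨hI, (integral_mono hI hint hpt).trans_eq ?_⟩
  rw [integral_add (hk1.const_mul _) (hintq.mul_const _), integral_const_mul, integral_mul_const,
    hk2, ← hNdef]
  have e1 : M * R = N ^ ((1:ℝ)/2) * M ^ (1 - q/2) := by
    rw [hRdef, show (1 - q/2) = 1 + (-q/2) by ring, Real.rpow_add hM, Real.rpow_one]; ring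
  have e2 : N * (M ^ (1 - q) / R) = N ^ ((1:ℝ)/2) * M ^ (1 - q/2) := by
    rw [← mul_div_assoc, div_eq_iff hR.ne', hRdef]
    have a1 : N = N ^ ((1:ℝ)/2) * N ^ ((1:ℝ)/2) := by
      rw [← Real.rpow_add hN]; norm_num
    have a2 : M ^ (1 - q) = M ^ (1 - q/2) * M ^ (-q/2) := by
      rw [← Real.rpow_add hM]; ring_nf
    rw [a2]; nth_rw 1 [a1]; ring
  rw [e2, mul_assoc _ (N ^ ((1:ℝ)/2)), ← e1]
  field_simp

lemma log_diff (a b : ℝ) (ha : 0 < a) (hb : 0 < b) :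
    |Real.log a - Real.log b| ≤ |a - b| * (a⁻¹ + b⁻¹) := by
  have key : ∀ a b : ℝ, 0 < a → 0 < b → Real.log a - Real.log b ≤ |a - b| * (a⁻¹ + b⁻¹) := by
    intro a b ha hb
    rw [← Real.log_div ha.ne' hb.ne']
    calc Real.log (a / b) ≤ a / b - 1 := Real.log_le_sub_one_of_pos (by positivity)
      _ = (a - b) * b⁻¹ := by field_simp
      _ ≤ |a - b| * b⁻¹ := by gcongr; exact le_abs_self _
      _ ≤ _ := by gcongr; simp [ha.le]
  rw [abs_le]
  have := key b a hb ha
  rw [abs_sub_comm b a, add_comm b⁻¹] at this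
  exact ⟨by linarith, key a b ha hb⟩

lemma log_int (ρ : E2 → ℝ) (hc : Continuous ρ)
    (hs : HasCompactSupport ρ) (x : E2) :
    Integrable (fun y : E2 => ρ y * Real.log ‖x - y‖) := by
  have h1 := (I_bound 1 le_rfl (by norm_num) ρ hc hs x).1
  have h2 : Integrable (fun y : E2 => |ρ y| * ‖x - y‖) := by
    refine Continuous.integrable_of_hasCompactSupport (by fun_prop) ?_
    exact HasCompactSupport.mul_right hs.abs
  refine (h2.add h1).mono' ?_ (Filter.Eventually.of_forall fun y => ?_)
  · exact (hc.measurable.mul (by fun_prop)).aestronglyMeasurable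
  · rw [norm_mul, Real.norm_eq_abs, Real.norm_eq_abs, Pi.add_apply, ← mul_add]
    gcongr
    rcases (norm_nonneg (x - y)).eq_or_lt with h | h
    · rw [← h]; simp
    · have i1 := Real.log_le_sub_one_of_pos h
      have i2 := Real.log_le_sub_one_of_pos (inv_pos.2 h)
      rw [Real.log_inv] at i2
      have := inv_pos.2 h
      rw [abs_le]; constructor <;> linarith

lemma Upot_lip (ρ : E2 → ℝ) (hc : Continuous ρ) (hs : HasCompactSupport ρ) (B : ℝ)
    (hB : ∀ x : E2, ∫ y : E2, |ρ y| * ‖x - y‖⁻¹ ≤ B) (x x' : E2) :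
    ‖Upot ρ x - Upot ρ x'‖ ≤ 4 * B * ‖x - x'‖ := by
  have i1 := fun x => (I_bound 1 le_rfl (by norm_num) ρ hc hs x).1
  unfold Upot
  rw [← mul_sub, ← integral_sub (log_int ρ hc hs x) (log_int ρ hc hs x'), norm_mul]
  have : ‖∫ y : E2, (ρ y * Real.log ‖x - y‖ - ρ y * Real.log ‖x' - y‖)‖ ≤
      ∫ y : E2, ‖x - x'‖ * (|ρ y| * ‖x - y‖⁻¹ + |ρ y| * ‖x' - y‖⁻¹) := by
    refine norm_integral_le_of_norm_le (((i1 x).add (i1 x')).const_mul _) ?_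
    have n1 : ∀ᵐ y : E2, y ≠ x := by simp [ae_iff]
    have n2 : ∀ᵐ y : E2, y ≠ x' := by simp [ae_iff]
    filter_upwards [n1, n2] with y h1 h2
    have p1 : 0 < ‖x - y‖ := norm_pos_iff.2 (sub_ne_zero.2 h1.symm)
    have p2 : 0 < ‖x' - y‖ := norm_pos_iff.2 (sub_ne_zero.2 h2.symm)
    rw [← mul_sub, norm_mul, Real.norm_eq_abs, Real.norm_eq_abs]
    have h3 : |‖x - y‖ - ‖x' - y‖| ≤ ‖x - x'‖ := by
      have := abs_norm_sub_norm_le (x - y) (x' - y)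
      simpa using this
    calc |ρ y| * |Real.log ‖x - y‖ - Real.log ‖x' - y‖|
        ≤ |ρ y| * (|‖x - y‖ - ‖x' - y‖| * (‖x - y‖⁻¹ + ‖x' - y‖⁻¹)) := by
          gcongr; exact log_diff _ _ p1 p2
      _ ≤ |ρ y| * (‖x - x'‖ * (‖x - y‖⁻¹ + ‖x' - y‖⁻¹)) := by gcongr
      _ = _ := by ring
  rw [integral_const_mul, integral_add (i1 x) (i1 x')] at this
  have h5 : ‖x - x'‖ * ((∫ y : E2, |ρ y| * ‖x - y‖⁻¹) + ∫ y : E2, |ρ y| * ‖x' - y‖⁻¹) ≤ ‖x - x'‖ * (B + B) := by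
    gcongr
    · exact hB x
    · exact hB x'
  have h6 : ‖(-2:ℝ)‖ = 2 := by norm_num
  rw [h6]
  linarith

/-- For every `q ∈ [1,2)` there is a constant `c₁ = c₁(q) > 0` such that for all
`ρ ∈ C¹_c(ℝ²)` one has `‖∇U_ρ‖_∞ ≤ c₁ ‖ρ‖_q^{q/2} ‖ρ‖_∞^{1-q/2}`.
Here `‖ρ‖_q^{q/2} = (∫ |ρ|^q)^{1/2}` and `‖ρ‖_∞ = ⨆ |ρ|`. -/
theorem stmt4 (q : ℝ) (hq1 : 1 ≤ q) (hq2 : q < 2) :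
    ∃ c₁ > (0:ℝ), ∀ ρ : E2 → ℝ, ContDiff ℝ 1 ρ → HasCompactSupport ρ → ∀ x : E2,
      ‖gradient (Upot ρ) x‖ ≤
        c₁ * (∫ y : E2, |ρ y| ^ q) ^ ((1:ℝ)/2) * (⨆ y : E2, |ρ y|) ^ (1 - q/2) := by
  have hK : 0 ≤ ∫ z : E2, kern (2/q) ‖z‖ := integral_nonneg fun z => by
    simp only [kern, Pi.zero_apply]; positivity
  refine ⟨4 * ((2:ℝ) ^ (2/q) * (∫ z : E2, kern (2/q) ‖z‖) + 1), by positivity, ?_⟩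
  intro ρ hρ hs x
  have hc := hρ.continuous
  have hb := fun x => (I_bound q hq1 hq2 ρ hc hs x).2
  have hB0 := le_trans (integral_nonneg fun y => by
    simp only [Pi.zero_apply]; positivity) (hb x)
  unfold gradient
  rw [LinearIsometryEquiv.norm_map]
  refine (norm_fderiv_le_of_lip' ℝ (mul_nonneg (by norm_num : (0:ℝ) ≤ 4) hB0)
    (Filter.Eventually.of_forall fun z => Upot_lip ρ hc hs _ hb z x)).trans_eq ?_
  ring
end
end

section
/- There exists a constant c₂ > 0 such that for all ρ ∈ C¹_c(ℝ²) the second derivatives of U_ρ satisfy ‖D²U_ρ‖_{L^∞(ℝ²)} ≤ c₂ [ (1 + ‖ρ‖_{L^∞(ℝ²)}) (1 + ln₊(‖∇ρ‖_{L^∞(ℝ²)})) + ‖ρ‖_{L¹(ℝ²)} ], where ln₊(s) = max{ln s, 0}. -/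
open MeasureTheory Real

noncomputable section

def kap : ℝ := (volume : Measure E2).real (Metric.ball 0 1)

lemma kap_nonneg : 0 ≤ kap := measureReal_nonneg

lemma phi1_integrable (d : ℝ) :
    Integrable (fun z : E2 => (Set.Iio d).indicator (fun r : ℝ => r⁻¹) ‖z‖) := by
  rw [integrable_fun_norm_addHaar (μ := (volume : Measure E2))
    (f := (Set.Iio d).indicator (fun r : ℝ => r⁻¹))]
  simp only [finrank_euclideanSpace, Fintype.card_fin]
  have : IntegrableOn ((Set.Iio d).indicator (fun _ : ℝ => (1:ℝ))) (Set.Ioi 0) := by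
    rw [IntegrableOn, integrable_indicator_iff measurableSet_Iio, IntegrableOn,
      Measure.restrict_restrict measurableSet_Iio]
    apply integrableOn_const (by
      rw [Set.Iio_inter_Ioi, Real.volume_Ioo]; exact ENNReal.ofReal_ne_top)
  refine (integrableOn_congr_fun ?_ measurableSet_Ioi).2 this
  intro y hy
  have hy : 0 < y := hy
  by_cases h : y < d <;> simp [h, hy.ne']

lemma phi1_integral {d : ℝ} (hd : 0 < d) :
    ∫ z : E2, (Set.Iio d).indicator (fun r : ℝ => r⁻¹) ‖z‖ = 2 * kap * d := by
  rw [integral_fun_norm_addHaar (μ := (volume : Measure E2))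
    ((Set.Iio d).indicator (fun r : ℝ => r⁻¹))]
  simp only [finrank_euclideanSpace, Fintype.card_fin]
  have : ∫ y in Set.Ioi (0:ℝ), y ^ (2-1) • (Set.Iio d).indicator (fun r : ℝ => r⁻¹) y
      = ∫ y in Set.Ioi (0:ℝ), (Set.Iio d).indicator (fun _ : ℝ => (1:ℝ)) y := by
    refine setIntegral_congr_fun measurableSet_Ioi ?_
    intro y hy
    have hy : 0 < y := hy
    by_cases h : y < d <;> simp [h, hy.ne']
  rw [this, setIntegral_indicator measurableSet_Iio, Set.Ioi_inter_Iio]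
  simp [kap, hd.le]; ring

lemma phi2_aux (d : ℝ) (hd : 0 < d) (y : ℝ) (hy : y ∈ Set.Ioi (0:ℝ)) :
   y ^ (2-1) • (Set.Ico d 1).indicator (fun r : ℝ => (r^2)⁻¹) y
      = (Set.Ico d 1).indicator (fun r : ℝ => r⁻¹) y := by
  have hy : 0 < y := hy
  by_cases h : y ∈ Set.Ico d 1
  · simp only [Set.indicator_of_mem h, smul_eq_mul, Nat.reduceSub, pow_one]; field_simp
  · simp only [Set.indicator_of_notMem h, smul_zero]

lemma phi2_integrable {d : ℝ} (hd : 0 < d) :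
    Integrable (fun z : E2 => (Set.Ico d 1).indicator (fun r : ℝ => (r^2)⁻¹) ‖z‖) := by
  rw [integrable_fun_norm_addHaar (μ := (volume : Measure E2))
    (f := (Set.Ico d 1).indicator (fun r : ℝ => (r^2)⁻¹))]
  simp only [finrank_euclideanSpace, Fintype.card_fin]
  refine (integrableOn_congr_fun (phi2_aux d hd) measurableSet_Ioi).2 ?_
  apply Integrable.integrableOn
  rw [integrable_indicator_iff measurableSet_Ico]
  apply IntegrableOn.mono_set (t := Set.Icc d 1) _ Set.Ico_subset_Icc_self
  apply ContinuousOn.integrableOn_Icc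
  apply continuousOn_inv₀.mono
  intro x hx
  exact (lt_of_lt_of_le hd hx.1).ne'

lemma phi2_integral {d : ℝ} (hd : 0 < d) (hd1 : d ≤ 1) :
    ∫ z : E2, (Set.Ico d 1).indicator (fun r : ℝ => (r^2)⁻¹) ‖z‖ = 2 * kap * log (1 / d) := by
  rw [integral_fun_norm_addHaar (μ := (volume : Measure E2))
    ((Set.Ico d 1).indicator (fun r : ℝ => (r^2)⁻¹))]
  simp only [finrank_euclideanSpace, Fintype.card_fin]
  rw [setIntegral_congr_fun measurableSet_Ioi (phi2_aux d hd), setIntegral_indicator measurableSet_Ico]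
  have : Set.Ioi 0 ∩ Set.Ico d 1 = Set.Ico d 1 := by
    apply Set.inter_eq_right.2
    intro x hx; exact lt_of_lt_of_le hd hx.1
  rw [this, integral_Ico_eq_integral_Ioc, ← intervalIntegral.integral_of_le hd1,
    integral_inv_of_pos hd one_pos]
  simp [kap]; ring

def C0 : ℝ := ∫ u : E2, ((1 + ‖u‖^2)^2)⁻¹

lemma C0_nonneg : 0 ≤ C0 := integral_nonneg fun u => by positivity

lemma C0_integrable : Integrable (fun u : E2 => ((1 + ‖u‖^2)^2)⁻¹) := by
  have := integrable_rpow_neg_one_add_norm_sq (μ := (volume : Measure E2)) (r := 4)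
    (by simp; norm_num)
  refine this.congr (Filter.Eventually.of_forall fun u => ?_)
  have h : (0:ℝ) < 1 + ‖u‖^2 := by positivity
  simp only
  rw [show (-4/2 : ℝ) = -((2:ℕ):ℝ) by norm_num, rpow_neg h.le, rpow_natCast]

lemma eps_scale {ε : ℝ} (hε : 0 < ε) (z : E2) :
    ε^2 * ((‖z‖^2 + ε^2)^2)⁻¹ = (ε⁻¹)^2 * ((1 + ‖ε⁻¹ • z‖^2)^2)⁻¹ := by
  rw [norm_smul, norm_inv, Real.norm_of_nonneg hε.le]
  field_simp
  ring

lemma eps_integrable {ε : ℝ} (hε : 0 < ε) :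
    Integrable (fun z : E2 => ε^2 * ((‖z‖^2 + ε^2)^2)⁻¹) := by
  simp_rw [eps_scale hε]
  exact ((C0_integrable).comp_smul (inv_ne_zero hε.ne')).const_mul _

lemma eps_integral {ε : ℝ} (hε : 0 < ε) :
    ∫ z : E2, ε^2 * ((‖z‖^2 + ε^2)^2)⁻¹ = C0 := by
  simp_rw [eps_scale hε]
  rw [integral_const_mul, Measure.integral_comp_smul volume (fun u : E2 => ((1 + ‖u‖^2)^2)⁻¹)]
  simp only [finrank_euclideanSpace, Fintype.card_fin, smul_eq_mul]
  rw [abs_of_nonneg (by positivity), ← C0]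
  field_simp

def Kr (ε : ℝ) (v w z : E2) : ℝ :=
  inner ℝ v w * (‖z‖^2 + ε^2)⁻¹ - 2 * inner ℝ z v * inner ℝ z w * ((‖z‖^2 + ε^2)^2)⁻¹

lemma Kr_cont {ε : ℝ} (hε : 0 < ε) (v w : E2) : Continuous (Kr ε v w) := by
  unfold Kr
  have h : ∀ z : E2, ‖z‖^2 + ε^2 ≠ 0 := fun z => by positivity
  have h2 : ∀ z : E2, (‖z‖^2 + ε^2)^2 ≠ 0 := fun z => by positivity
  fun_prop (disch := assumption)

lemma Kr_bound {ε : ℝ} (hε : 0 < ε) (v w z : E2) :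
    |Kr ε v w z| ≤ 3 * (‖z‖^2 + ε^2)⁻¹ * (‖v‖ * ‖w‖) := by
  unfold Kr
  have q : 0 < ‖z‖^2 + ε^2 := by positivity
  have h1 := abs_real_inner_le_norm v w
  have h2 := abs_real_inner_le_norm z v
  have h3 := abs_real_inner_le_norm z w
  have h4 : ‖z‖^2 ≤ ‖z‖^2 + ε^2 := by nlinarith
  calc _ ≤ |inner ℝ v w * (‖z‖^2 + ε^2)⁻¹| + |2 * inner ℝ z v * inner ℝ z w * ((‖z‖^2 + ε^2)^2)⁻¹| := abs_sub _ _
    _ = |inner ℝ v w| * (‖z‖^2 + ε^2)⁻¹ + 2 * (|inner ℝ z v| * |inner ℝ z w|) * ((‖z‖^2 + ε^2)^2)⁻¹ := by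
      simp only [abs_mul, abs_inv, abs_pow, abs_of_pos q, abs_two]; ring
    _ ≤ (‖v‖ * ‖w‖) * (‖z‖^2 + ε^2)⁻¹ + 2 * ((‖z‖ * ‖v‖) * (‖z‖ * ‖w‖)) * ((‖z‖^2 + ε^2)^2)⁻¹ := by
      gcongr
    _ = (‖v‖ * ‖w‖) * (‖z‖^2 + ε^2)⁻¹ + 2 * (‖z‖^2 * (‖v‖ * ‖w‖)) * ((‖z‖^2 + ε^2)^2)⁻¹ := by ring
    _ ≤ (‖v‖ * ‖w‖) * (‖z‖^2 + ε^2)⁻¹ + 2 * ((‖z‖^2 + ε^2) * (‖v‖ * ‖w‖)) * ((‖z‖^2 + ε^2)^2)⁻¹ := by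
      gcongr
    _ = _ := by field_simp; ring

instance fact2 : Fact (Module.finrank ℝ E2 = 2) := ⟨by simp⟩

def ori : Orientation ℝ E2 (Fin 2) := (EuclideanSpace.basisFun (Fin 2) ℝ).toBasis.orientation

lemma Kr_rot {ε : ℝ} (hε : 0 < ε) (v w z : E2) :
    Kr ε v w z + Kr ε v w (ori.rightAngleRotation z)
      = 2 * inner ℝ v w * (ε^2 * ((‖z‖^2 + ε^2)^2)⁻¹) := by
  have q : 0 < ‖z‖^2 + ε^2 := by positivity
  have h := ori.inner_mul_inner_add_areaForm_mul_areaForm z v w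
  unfold Kr
  rw [LinearIsometryEquiv.norm_map, ori.inner_rightAngleRotation_left, ori.inner_rightAngleRotation_left]
  field_simp
  linear_combination (-2) * h

lemma int_ball {f : E2 → ℝ} (hf : Continuous f) (d : ℝ) : IntegrableOn f (Metric.ball 0 d) :=
  (hf.continuousOn.integrableOn_compact (isCompact_closedBall 0 d)).mono_set
    Metric.ball_subset_closedBall

lemma Kr_ball {ε : ℝ} (hε : 0 < ε) (v w : E2) (d : ℝ) :
    |∫ z in Metric.ball (0:E2) d, Kr ε v w z| ≤ C0 * (‖v‖ * ‖w‖) := by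
  set J := ori.rightAngleRotation
  have hint : IntegrableOn (Kr ε v w) (Metric.ball 0 d) :=
    int_ball (Kr_cont hε v w) d
  have hpre : J ⁻¹' Metric.ball (0:E2) d = Metric.ball 0 d := by
    ext z; simp
  have hJ : ∫ z in Metric.ball (0:E2) d, Kr ε v w (J z) = ∫ z in Metric.ball (0:E2) d, Kr ε v w z := by
    have := J.measurePreserving.setIntegral_preimage_emb J.toMeasurableEquiv.measurableEmbedding (Kr ε v w) (Metric.ball 0 d)
    rwa [hpre] at this
  have hint2 : IntegrableOn (fun z => Kr ε v w (J z)) (Metric.ball 0 d) :=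
    int_ball ((Kr_cont hε v w).comp J.continuous) d
  have h2 : 2 * ∫ z in Metric.ball (0:E2) d, Kr ε v w z
      = 2 * inner ℝ v w * ∫ z in Metric.ball (0:E2) d, (ε^2 * ((‖z‖^2 + ε^2)^2)⁻¹) := by
    rw [← integral_const_mul (2 * inner ℝ v w)]
    simp_rw [← Kr_rot hε v w]
    rw [integral_add hint hint2, hJ]
    ring
  have h3 : ∫ z in Metric.ball (0:E2) d, Kr ε v w z
      = inner ℝ v w * ∫ z in Metric.ball (0:E2) d, (ε^2 * ((‖z‖^2 + ε^2)^2)⁻¹) := by linarith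
  have h4 : 0 ≤ ∫ z in Metric.ball (0:E2) d, (ε^2 * ((‖z‖^2 + ε^2)^2)⁻¹) := integral_nonneg fun z => by positivity
  have h5 : ∫ z in Metric.ball (0:E2) d, (ε^2 * ((‖z‖^2 + ε^2)^2)⁻¹) ≤ C0 := by
    rw [← eps_integral hε]
    exact setIntegral_le_integral (eps_integrable hε) (Filter.Eventually.of_forall fun z => by simp only [Pi.zero_apply]; positivity)
  rw [h3, abs_mul, abs_of_nonneg h4, mul_comm]
  gcongr
  · exact C0_nonneg
  · exact abs_real_inner_le_norm v w

lemma kernel_bound {ρ : E2 → ℝ} (hρ : Continuous ρ) (hi : Integrable ρ) {R G d : ℝ}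
    (hR : ∀ y, |ρ y| ≤ R) (hG0 : 0 ≤ G) (hG : ∀ x y, |ρ x - ρ y| ≤ G * ‖x - y‖) (hd : 0 < d) (hd1 : d ≤ 1)
    {ε : ℝ} (hε : 0 < ε) (x v w : E2) :
    |∫ z, ρ (x - z) * Kr ε v w z| ≤
      (3 * (G * (2 * kap * d) + R * (2 * kap * log (1/d)) + ∫ y, |ρ y|) + R * C0) * (‖v‖ * ‖w‖) := by
  have hR0 : 0 ≤ R := (abs_nonneg _).trans (hR 0)
  set B := Metric.ball (0:E2) d
  have hB : MeasurableSet B := Metric.isOpen_ball.measurableSet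
  have hii : Integrable (fun z => ρ (x - z)) := hi.comp_sub_left x
  have hbd : ∀ z, ‖Kr ε v w z‖ ≤ 3 * (ε^2)⁻¹ * (‖v‖*‖w‖) := fun z => by
    refine (Kr_bound hε v w z).trans ?_
    gcongr
    nlinarith [sq_nonneg ‖z‖]
  have hi1 : Integrable (fun z => ρ (x - z) * Kr ε v w z) :=
    hii.mul_bdd (Kr_cont hε v w).aestronglyMeasurable (Filter.Eventually.of_forall hbd)
  have hi2 : Integrable (B.indicator (Kr ε v w)) :=
    (int_ball (Kr_cont hε v w) d).integrable_indicator hB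
  have split : ∫ z, ρ (x - z) * Kr ε v w z =
      (∫ z, (ρ (x - z) * Kr ε v w z - ρ x * B.indicator (Kr ε v w) z)) + ρ x * ∫ z in B, Kr ε v w z := by
    rw [integral_sub hi1 (hi2.const_mul _), integral_const_mul, integral_indicator hB]; ring
  set g : E2 → ℝ := fun z => 3 * (G * (Set.Iio d).indicator (fun r : ℝ => r⁻¹) ‖z‖ +
      R * (Set.Ico d 1).indicator (fun r : ℝ => (r^2)⁻¹) ‖z‖ + |ρ (x - z)|) * (‖v‖ * ‖w‖)
  have i1 : Integrable (fun z : E2 => G * (Set.Iio d).indicator (fun r : ℝ => r⁻¹) ‖z‖) := (phi1_integrable d).const_mul G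
  have i2 : Integrable (fun z : E2 => R * (Set.Ico d 1).indicator (fun r : ℝ => (r^2)⁻¹) ‖z‖) := (phi2_integrable hd).const_mul R
  have i12 : Integrable (fun z : E2 => G * (Set.Iio d).indicator (fun r : ℝ => r⁻¹) ‖z‖ +
      R * (Set.Ico d 1).indicator (fun r : ℝ => (r^2)⁻¹) ‖z‖) := i1.add i2
  have gi : Integrable g := (((i1.add i2).add hii.abs).const_mul 3).mul_const _
  have gint : ∫ z, g z = 3 * (G * (2 * kap * d) + R * (2 * kap * log (1/d)) + ∫ y, |ρ y|) * (‖v‖*‖w‖) := by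
    simp only [g]
    rw [integral_mul_const, integral_const_mul, integral_add i12 hii.abs, integral_add i1 i2,
      integral_const_mul, integral_const_mul, phi1_integral hd, phi2_integral hd hd1,
      integral_sub_left_eq_self (fun y => |ρ y|)]
  have pt : ∀ z, ‖ρ (x - z) * Kr ε v w z - ρ x * B.indicator (Kr ε v w) z‖ ≤ g z := by
    intro z
    have hK := Kr_bound hε v w z
    have q : 0 < ‖z‖^2 + ε^2 := by positivity
    have hvw : 0 ≤ ‖v‖ * ‖w‖ := by positivity
    rw [Real.norm_eq_abs]
    simp only [g]
    by_cases h1 : ‖z‖ < d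
    · have hz : z ∈ B := by simpa [B] using h1
      have hz2 : ‖z‖ ∉ Set.Ico d 1 := fun h => absurd h.1 (not_le.2 h1)
      rw [Set.indicator_of_mem hz, Set.indicator_of_mem (show ‖z‖ ∈ Set.Iio d from h1),
        Set.indicator_of_notMem hz2, ← sub_mul, abs_mul]
      have hl := hG (x - z) x
      rw [show x - z - x = -z by abel, norm_neg] at hl
      have hq : ‖z‖ * (‖z‖^2 + ε^2)⁻¹ ≤ ‖z‖⁻¹ := by
        rcases (norm_nonneg z).eq_or_lt with h0 | h0
        · rw [← h0]; simp
        · rw [← div_eq_mul_inv, div_le_iff₀ q, inv_mul_eq_div, le_div_iff₀ h0]; nlinarith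
      calc _ ≤ (G * ‖z‖) * (3 * (‖z‖^2 + ε^2)⁻¹ * (‖v‖ * ‖w‖)) := by gcongr
        _ = 3 * (G * (‖z‖ * (‖z‖^2 + ε^2)⁻¹)) * (‖v‖ * ‖w‖) := by ring
        _ ≤ 3 * (G * ‖z‖⁻¹) * (‖v‖ * ‖w‖) := by gcongr
        _ ≤ _ := by
          gcongr
          have := abs_nonneg (ρ (x - z))
          linarith
    · have hz : z ∉ B := by simpa [B] using h1
      have hz0 : 0 < ‖z‖ := lt_of_lt_of_le hd (not_lt.1 h1)
      have hq : (‖z‖^2 + ε^2)⁻¹ ≤ (‖z‖^2)⁻¹ := by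
        gcongr
        nlinarith
      rw [Set.indicator_of_notMem hz, Set.indicator_of_notMem (show ‖z‖ ∉ Set.Iio d from h1), mul_zero, sub_zero,
        abs_mul]
      by_cases h2 : ‖z‖ < 1
      · rw [Set.indicator_of_mem (show ‖z‖ ∈ Set.Ico d 1 from ⟨not_lt.1 h1, h2⟩)]
        calc _ ≤ R * (3 * (‖z‖^2)⁻¹ * (‖v‖ * ‖w‖)) := by
              gcongr
              · exact hR _
              · refine hK.trans ?_; gcongr
          _ = 3 * (R * (‖z‖^2)⁻¹) * (‖v‖ * ‖w‖) := by ring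
          _ ≤ _ := by
            gcongr
            have := abs_nonneg (ρ (x - z))
            linarith
      · rw [Set.indicator_of_notMem (show ‖z‖ ∉ Set.Ico d 1 from fun h => h2 h.2)]
        have h3 : (‖z‖^2)⁻¹ ≤ 1 := inv_le_one_of_one_le₀ (by nlinarith)
        calc _ ≤ |ρ (x - z)| * (3 * 1 * (‖v‖ * ‖w‖)) := by
              gcongr
              refine hK.trans ?_
              gcongr
              exact hq.trans h3
          _ = _ := by ring
  rw [split]
  have e1 : |∫ z, (ρ (x - z) * Kr ε v w z - ρ x * B.indicator (Kr ε v w) z)| ≤ ∫ z, g z :=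
    norm_integral_le_of_norm_le gi (Filter.Eventually.of_forall pt)
  have e2 : |ρ x * ∫ z in B, Kr ε v w z| ≤ R * (C0 * (‖v‖ * ‖w‖)) := by
    rw [abs_mul]
    gcongr
    · exact hR x
    · exact Kr_ball hε v w d
  rw [gint] at e1
  refine (abs_add_le _ _).trans ((add_le_add e1 e2).trans (le_of_eq ?_))
  ring

lemma inv_locInt : LocallyIntegrable (fun z : E2 => ‖z‖⁻¹) := by
  rw [locallyIntegrable_iff]
  intro K hK
  obtain ⟨r, hr⟩ := hK.isBounded.subset_ball 0
  refine IntegrableOn.mono_set ?_ hr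
  refine (phi1_integrable r).integrableOn.congr_fun ?_ Metric.isOpen_ball.measurableSet
  intro z hz
  have : ‖z‖ ∈ Set.Iio r := by simpa using hz
  simp only [Set.indicator_of_mem this]

lemma log_locInt : LocallyIntegrable (fun z : E2 => log ‖z‖) := by
  have h : LocallyIntegrable (fun z : E2 => ‖z‖ + ‖z‖⁻¹) :=
    (continuous_norm.locallyIntegrable).add inv_locInt
  refine h.mono (measurable_norm.log.aestronglyMeasurable) (Filter.Eventually.of_forall fun z => ?_)
  have h0 := norm_nonneg z
  have h1 : 0 ≤ ‖z‖⁻¹ := by positivity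
  rw [Real.norm_eq_abs, Real.norm_of_nonneg (by positivity), abs_le]
  constructor
  · have := Real.log_le_self h1
    rw [Real.log_inv] at this
    linarith
  · have := Real.log_le_self h0
    linarith

lemma fderiv_pot {ρ f : E2 → ℝ} (hf : LocallyIntegrable f) (hρ : ContDiff ℝ 1 ρ)
    (hc : HasCompactSupport ρ) (x : E2) :
    ∃ D : E2 →L[ℝ] ℝ, HasFDerivAt (fun x => ∫ y, ρ y * f (x - y)) D x ∧
      ∀ v, D v = ∫ t, f t * fderiv ℝ ρ (x - t) v := by
  have h := hc.hasFDerivAt_convolution_right (ContinuousLinearMap.lsmul ℝ ℝ) hf hρ x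
  refine ⟨_, h.congr_of_eventuallyEq (Filter.Eventually.of_forall fun x => ?_), fun v => ?_⟩
  · rw [convolution_lsmul_swap]
    simp only [smul_eq_mul, mul_comm]
  · rw [convolution_precompR_apply _ hf (hc.fderiv ℝ) (hρ.continuous_fderiv one_ne_zero)]
    rfl

lemma fderiv_dom {ρ g : E2 → ℝ} {g' : E2 → E2 →L[ℝ] ℝ} (hρ : Continuous ρ) (hc : HasCompactSupport ρ)
    (hg : ∀ z, HasFDerivAt g (g' z) z) (hg' : Continuous g') {C : ℝ} (hC : ∀ z, ‖g' z‖ ≤ C) (x : E2) :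
    HasFDerivAt (fun x => ∫ y, ρ y * g (x - y)) (∫ y, ρ y • g' (x - y)) x := by
  have hgc : Continuous g := continuous_iff_continuousAt.2 fun z => (hg z).continuousAt
  have hi : Integrable ρ := hρ.integrable_of_hasCompactSupport hc
  refine hasFDerivAt_integral_of_dominated_of_fderiv_le (F := fun x y => ρ y * g (x - y))
    (F' := fun x y => ρ y • g' (x - y)) (bound := fun y => ‖ρ y‖ * C) (s := Set.univ) Filter.univ_mem
    (Filter.Eventually.of_forall fun x => ?_) ?_ ?_ (Filter.Eventually.of_forall fun y x _ => ?_)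
    (hi.norm.mul_const C) (Filter.Eventually.of_forall fun y x _ => ?_)
  · exact Continuous.aestronglyMeasurable (by fun_prop)
  · exact Continuous.integrable_of_hasCompactSupport (by fun_prop) hc.mul_right
  · exact Continuous.aestronglyMeasurable (by fun_prop)
  · rw [norm_smul]; gcongr; exact hC _
  · have := ((hg (x - y)).comp x ((hasFDerivAt_id x).sub_const y)).const_mul (ρ y)
    simpa using this

def Lg (ε : ℝ) (z : E2) : ℝ := (1/2) * log (‖z‖^2 + ε^2)
def Lg' (ε : ℝ) (z : E2) : E2 →L[ℝ] ℝ := (‖z‖^2 + ε^2)⁻¹ • innerSL ℝ z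
def kv (ε : ℝ) (v z : E2) : ℝ := inner ℝ z v * (‖z‖^2 + ε^2)⁻¹
def kv' (ε : ℝ) (v z : E2) : E2 →L[ℝ] ℝ := (‖z‖^2 + ε^2)⁻¹ • innerSL ℝ v -
  (2 * inner ℝ z v * ((‖z‖^2 + ε^2)^2)⁻¹) • innerSL ℝ z

lemma Lg_deriv {ε : ℝ} (hε : 0 < ε) (z : E2) : HasFDerivAt (Lg ε) (Lg' ε z) z := by
  have q : ‖z‖^2 + ε^2 ≠ 0 := by positivity
  have := (((hasStrictFDerivAt_norm_sq z).hasFDerivAt.add_const (ε^2)).log q).const_mul (1/2)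
  refine HasFDerivAt.congr_fderiv (f := Lg ε) this ?_
  ext w
  simp [Lg']
  ring

lemma kv_deriv {ε : ℝ} (hε : 0 < ε) (v z : E2) : HasFDerivAt (kv ε v) (kv' ε v z) z := by
  have q : ‖z‖^2 + ε^2 ≠ 0 := by positivity
  have h1 : HasFDerivAt (fun z => inner ℝ z v) (innerSL ℝ v) z := by
    simpa [real_inner_comm] using (innerSL ℝ v).hasFDerivAt (x := z)
  have h2 := (hasDerivAt_inv q).comp_hasFDerivAt z ((hasStrictFDerivAt_norm_sq z).hasFDerivAt.add_const (ε^2))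
  have := h1.mul h2
  refine HasFDerivAt.congr_fderiv (f := kv ε v) this ?_
  ext w
  simp [kv']
  field_simp
  ring

lemma kv'_apply (ε : ℝ) (v z w : E2) : kv' ε v z w = Kr ε v w z := by
  simp [kv', Kr]; ring

lemma Lg'_cont {ε : ℝ} (hε : 0 < ε) : Continuous (Lg' ε) := by
  unfold Lg'
  have h : ∀ z : E2, ‖z‖^2 + ε^2 ≠ 0 := fun z => by positivity
  fun_prop (disch := assumption)

lemma kv'_cont {ε : ℝ} (hε : 0 < ε) (v : E2) : Continuous (kv' ε v) := by
  unfold kv'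
  have h : ∀ z : E2, ‖z‖^2 + ε^2 ≠ 0 := fun z => by positivity
  have h2 : ∀ z : E2, (‖z‖^2 + ε^2)^2 ≠ 0 := fun z => by positivity
  fun_prop (disch := assumption)

lemma Lg'_bound {ε : ℝ} (hε : 0 < ε) (z : E2) : ‖Lg' ε z‖ ≤ ε⁻¹ := by
  have q : 0 < ‖z‖^2 + ε^2 := by positivity
  rw [Lg', norm_smul, innerSL_apply_norm, norm_inv, Real.norm_of_nonneg q.le, inv_mul_eq_div,
    div_le_iff₀ q, inv_mul_eq_div, le_div_iff₀ hε]
  nlinarith [sq_nonneg (‖z‖ - ε), sq_nonneg ‖z‖]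

lemma kv'_bound {ε : ℝ} (hε : 0 < ε) (v z : E2) : ‖kv' ε v z‖ ≤ 3 * (ε^2)⁻¹ * ‖v‖ := by
  refine ContinuousLinearMap.opNorm_le_bound _ (by positivity) fun w => ?_
  rw [kv'_apply]
  refine (Kr_bound hε v w z).trans ?_
  rw [mul_assoc (3 * (ε^2)⁻¹)]
  gcongr
  nlinarith [sq_nonneg ‖z‖]

lemma Lg_close {ε : ℝ} (hε : 0 < ε) {z : E2} (hz : z ≠ 0) : |Lg ε z - log ‖z‖| ≤ ε * ‖z‖⁻¹ := by
  have h0 : 0 < ‖z‖ := norm_pos_iff.2 hz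
  have e : Lg ε z - log ‖z‖ = (1/2) * log (1 + (ε * ‖z‖⁻¹)^2) := by
    have : ‖z‖^2 + ε^2 = ‖z‖^2 * (1 + (ε * ‖z‖⁻¹)^2) := by field_simp
    rw [Lg, this, log_mul (by positivity) (by positivity), log_pow]
    push_cast; ring
  have hs : 0 < ε * ‖z‖⁻¹ := by positivity
  rw [e, abs_of_nonneg (by have := Real.log_nonneg (x := 1 + (ε * ‖z‖⁻¹)^2) (by nlinarith); positivity)]
  have : log (1 + (ε * ‖z‖⁻¹)^2) ≤ log ((1 + ε * ‖z‖⁻¹)^2) :=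
    Real.log_le_log (by positivity) (by nlinarith)
  rw [log_pow] at this
  have h2 := Real.log_le_sub_one_of_pos (x := 1 + ε * ‖z‖⁻¹) (by positivity)
  push_cast at this
  linarith

lemma reg_lip {ρ : E2 → ℝ} (hρ : ContDiff ℝ 1 ρ) (hc : HasCompactSupport ρ) {R G d : ℝ}
    (hR : ∀ y, |ρ y| ≤ R) (hG0 : 0 ≤ G) (hG : ∀ x y, |ρ x - ρ y| ≤ G * ‖x - y‖) (hd : 0 < d) (hd1 : d ≤ 1)
    {ε : ℝ} (hε : 0 < ε) (x x' v : E2) :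
    |(∫ t, Lg ε t * fderiv ℝ ρ (x - t) v) - ∫ t, Lg ε t * fderiv ℝ ρ (x' - t) v| ≤
      (3 * (G * (2 * kap * d) + R * (2 * kap * log (1/d)) + ∫ y, |ρ y|) + R * C0) * ‖v‖ * ‖x - x'‖ := by
  have hi : Integrable ρ := hρ.continuous.integrable_of_hasCompactSupport hc
  set M := (3 * (G * (2 * kap * d) + R * (2 * kap * log (1/d)) + ∫ y, |ρ y|) + R * C0)
  have hR0 : 0 ≤ R := (abs_nonneg _).trans (hR 0)
  have hM : 0 ≤ M := by
    have := kap_nonneg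
    have := C0_nonneg
    have : 0 ≤ log (1/d) := Real.log_nonneg (by rw [le_div_iff₀ hd]; linarith)
    have : 0 ≤ ∫ y, |ρ y| := integral_nonneg fun y => abs_nonneg _
    positivity
  have hLc : Continuous (Lg ε) := continuous_iff_continuousAt.2 fun z => (Lg_deriv hε z).continuousAt
  have key : ∀ x, ∫ t, Lg ε t * fderiv ℝ ρ (x - t) v = ∫ y, ρ y * kv ε v (x - y) := by
    intro x
    obtain ⟨D, hD, hDv⟩ := fderiv_pot hLc.locallyIntegrable hρ hc x
    have h2 := fderiv_dom hρ.continuous hc (Lg_deriv hε) (Lg'_cont hε) (Lg'_bound hε) x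
    rw [← hDv, hD.unique h2, ContinuousLinearMap.integral_apply]
    · simp [Lg', kv, mul_comm, inner_sub_left]
    · have := Lg'_cont hε
      have := hρ.continuous
      exact Continuous.integrable_of_hasCompactSupport (by fun_prop) hc.smul_right
  rw [key, key]
  refine Convex.norm_image_sub_le_of_norm_hasFDerivWithin_le (𝕜 := ℝ) (s := Set.univ)
    (f := fun x => ∫ y, ρ y * kv ε v (x - y)) (f' := fun x => ∫ y, ρ y • kv' ε v (x - y))
    (fun x _ => (fderiv_dom hρ.continuous hc (kv_deriv hε v) (kv'_cont hε v)
      (kv'_bound hε v) x).hasFDerivWithinAt) (fun x _ => ?_) convex_univ trivial trivial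
  refine ContinuousLinearMap.opNorm_le_bound _ (by positivity) fun w => ?_
  have hii : Integrable (fun y => ρ y • kv' ε v (x - y)) := by
    have := kv'_cont hε v
    have := hρ.continuous
    exact Continuous.integrable_of_hasCompactSupport (by fun_prop) hc.smul_right
  rw [ContinuousLinearMap.integral_apply hii]
  have : ∫ y, (ρ y • kv' ε v (x - y)) w = ∫ z, ρ (x - z) * Kr ε v w z := by
    rw [← integral_sub_left_eq_self _ _ x]
    simp [kv'_apply]
  rw [this, Real.norm_eq_abs, mul_assoc]
  exact kernel_bound hρ.continuous hi hR hG0 hG hd hd1 hε x v w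

lemma log_lip {ρ : E2 → ℝ} (hρ : ContDiff ℝ 1 ρ) (hc : HasCompactSupport ρ) {M : ℝ} (x x' v : E2)
    (h : ∀ ε > 0, |(∫ t, Lg ε t * fderiv ℝ ρ (x - t) v) - ∫ t, Lg ε t * fderiv ℝ ρ (x' - t) v| ≤ M) :
    |(∫ t : E2, log ‖t‖ * fderiv ℝ ρ (x - t) v) - ∫ t : E2, log ‖t‖ * fderiv ℝ ρ (x' - t) v| ≤ M := by
  have hdc : Continuous (fun y => fderiv ℝ ρ y v) := by
    have := hρ.continuous_fderiv one_ne_zero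
    fun_prop
  have hds : HasCompactSupport (fun y => fderiv ℝ ρ y v) := hc.fderiv_apply ℝ v
  have hint : ∀ f : E2 → ℝ, LocallyIntegrable f → ∀ x, Integrable (fun t => f t * fderiv ℝ ρ (x - t) v) := by
    intro f hf x
    exact hf.integrable_smul_right_of_hasCompactSupport (g := fun t => fderiv ℝ ρ (x - t) v)
      (by fun_prop) (hds.comp_homeomorph (Homeomorph.subLeft x))
  have close : ∀ x, ∃ C ≥ 0, ∀ ε > 0, |(∫ t, Lg ε t * fderiv ℝ ρ (x - t) v) -
      ∫ t : E2, log ‖t‖ * fderiv ℝ ρ (x - t) v| ≤ ε * C := by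
    intro x
    refine ⟨∫ t : E2, ‖‖t‖⁻¹ * fderiv ℝ ρ (x - t) v‖, integral_nonneg fun t => norm_nonneg _, fun ε hε => ?_⟩
    have hLc : Continuous (Lg ε) := continuous_iff_continuousAt.2 fun z => (Lg_deriv hε z).continuousAt
    rw [← integral_sub (hint _ hLc.locallyIntegrable x) (hint _ log_locInt x), ← integral_const_mul]
    rw [← Real.norm_eq_abs]
    refine norm_integral_le_of_norm_le ((hint _ inv_locInt x).norm.const_mul ε) ?_
    filter_upwards [compl_mem_ae_iff.2 (measure_singleton (0:E2))] with t ht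
    have ht : t ≠ 0 := ht
    have := Lg_close hε ht
    rw [← sub_mul, norm_mul, norm_mul, Real.norm_eq_abs, ← mul_assoc, norm_inv, norm_norm]
    gcongr
  obtain ⟨C, hC0, hC⟩ := close x
  obtain ⟨C', hC0', hC'⟩ := close x'
  refine le_of_forall_pos_le_add fun δ hδ => ?_
  have hε : 0 < δ / (C + C' + 1) := by positivity
  have h1 := abs_le.1 (h _ hε)
  have h2 := abs_le.1 (hC _ hε)
  have h3 := abs_le.1 (hC' _ hε)
  have h4 : δ / (C + C' + 1) * C + δ / (C + C' + 1) * C' ≤ δ := by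
    rw [← mul_add, div_mul_eq_mul_div, div_le_iff₀ (by positivity)]
    nlinarith
  rw [abs_le]
  constructor <;> linarith [h1.1, h1.2, h2.1, h2.2, h3.1, h3.2]

/-- There is a constant `c₂ > 0` such that for all `ρ ∈ C¹_c(ℝ²)` the second derivatives of
`U_ρ` satisfy `‖D²U_ρ‖_∞ ≤ c₂ [(1 + ‖ρ‖_∞)(1 + ln₊ ‖∇ρ‖_∞) + ‖ρ‖_{L¹}]`,
where `ln₊ s = max (ln s) 0`. -/
theorem stmt5 :
    ∃ c₂ > (0:ℝ), ∀ ρ : E2 → ℝ, ContDiff ℝ 1 ρ → HasCompactSupport ρ → ∀ x : E2,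
      ‖iteratedFDeriv ℝ 2 (Upot ρ) x‖ ≤
        c₂ * ((1 + ⨆ y : E2, |ρ y|) * (1 + max (Real.log (⨆ y : E2, ‖gradient ρ y‖)) 0)
          + ∫ y : E2, |ρ y|) := by
  have hk := kap_nonneg
  have hC0 := C0_nonneg
  refine ⟨2 * (6 * kap + C0 + 3), by positivity, fun ρ hρ hc x => ?_⟩
  set R := ⨆ y : E2, |ρ y| with hRdef
  set G := ⨆ y : E2, ‖gradient ρ y‖ with hGdef
  set N := ∫ y : E2, |ρ y|
  have hfc := hρ.continuous_fderiv one_ne_zero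
  have hgn : ∀ y, ‖gradient ρ y‖ = ‖fderiv ℝ ρ y‖ := fun y => by simp [gradient]
  have hR : ∀ y, |ρ y| ≤ R := fun y =>
    le_ciSup (f := fun y => |ρ y|) (hρ.continuous.norm.bddAbove_range_of_hasCompactSupport hc.norm) y
  have hG' : ∀ y, ‖fderiv ℝ ρ y‖ ≤ G := fun y => by
    simp_rw [hGdef, hgn]
    exact le_ciSup (f := fun y => ‖fderiv ℝ ρ y‖)
      (hfc.norm.bddAbove_range_of_hasCompactSupport (hc.fderiv ℝ).norm) y
  have hR0 : 0 ≤ R := (abs_nonneg _).trans (hR 0)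
  have hG0 : 0 ≤ G := (norm_nonneg _).trans (hG' 0)
  have hN : 0 ≤ N := integral_nonneg fun y => abs_nonneg _
  have hG : ∀ x y, |ρ x - ρ y| ≤ G * ‖x - y‖ := fun x y =>
    Convex.norm_image_sub_le_of_norm_fderiv_le (𝕜 := ℝ) (s := Set.univ)
      (fun z _ => (hρ.differentiable one_ne_zero) z) (fun z _ => hG' z) convex_univ trivial trivial
  set l := max (Real.log G) 0
  have hl0 : 0 ≤ l := le_max_right _ _
  have hm : 0 < max G 1 := lt_max_of_lt_right one_pos
  set d := (max G 1)⁻¹ with hddef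
  have hd : 0 < d := inv_pos.2 hm
  have hd1 : d ≤ 1 := inv_le_one_of_one_le₀ (le_max_right _ _)
  have hGd : G * d ≤ 1 := by
    rw [hddef, ← div_eq_mul_inv, div_le_one hm]; exact le_max_left _ _
  have hld : log (1/d) ≤ l := by
    rw [hddef, one_div, inv_inv]
    rcases le_total G 1 with h | h
    · rw [max_eq_right h, log_one]; exact hl0
    · rw [max_eq_left h]; exact le_max_left _ _
  set M := (3 * (G * (2 * kap * d) + R * (2 * kap * log (1/d)) + N) + R * C0) with hMdef
  have hlog0 : 0 ≤ log (1/d) := Real.log_nonneg (by rw [le_div_iff₀ hd]; linarith)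
  have hM0 : 0 ≤ M := by positivity
  have hM : M ≤ (6 * kap + C0 + 3) * ((1 + R) * (1 + l) + N) := by
    have e1 : kap * (G * d) ≤ kap * 1 := by gcongr
    have e2 : kap * (R * log (1/d)) ≤ kap * (R * l) := by gcongr
    have p1 : 0 ≤ R * l := by positivity
    have p2 : 0 ≤ kap * R := by positivity
    have p3 : 0 ≤ kap * l := by positivity
    have p4 : 0 ≤ kap * N := by positivity
    have p5 : 0 ≤ C0 * N := by positivity
    have p6 : 0 ≤ C0 * l := by positivity
    have p7 : 0 ≤ C0 * (R * l) := by positivity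
    have : M = 6 * (kap * (G * d)) + 6 * (kap * (R * log (1/d))) + 3 * N + R * C0 := by
      rw [hMdef]; ring
    rw [this]
    linarith
  have hder : ∀ y v, fderiv ℝ (Upot ρ) y v = -2 * ∫ t : E2, log ‖t‖ * fderiv ℝ ρ (y - t) v := by
    intro y v
    obtain ⟨D, hD, hDv⟩ := fderiv_pot log_locInt hρ hc y
    have : HasFDerivAt (Upot ρ) ((-2 : ℝ) • D) y := hD.const_mul (-2)
    rw [this.fderiv, ← hDv]; rfl
  have hlip : ∀ y, ‖fderiv ℝ (Upot ρ) y - fderiv ℝ (Upot ρ) x‖ ≤ (2 * M) * ‖y - x‖ := by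
    intro y
    refine ContinuousLinearMap.opNorm_le_bound _ (by positivity) fun v => ?_
    rw [sub_apply, hder, hder, ← mul_sub, norm_mul]
    have := log_lip hρ hc y x v (fun ε hε => reg_lip hρ hc hR hG0 hG hd hd1 hε y x v)
    rw [Real.norm_eq_abs, Real.norm_eq_abs, abs_neg, abs_two]
    calc _ ≤ 2 * (M * ‖v‖ * ‖y - x‖) := by gcongr
      _ = _ := by ring
  rw [← norm_iteratedFDeriv_fderiv (n := 1), norm_iteratedFDeriv_one]
  refine (norm_fderiv_le_of_lip' ℝ (C := 2 * M) (by positivity) (Filter.Eventually.of_forall hlip)).trans ?_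
  linarith
end
end

section
/- (Logarithmic Hardy–Littlewood–Sobolev inequality.) There exists a constant C > 0 such that for every ρ ∈ L¹(ℝ²) which is non-negative almost everywhere, not identically zero, and satisfies that ∫_{ℝ²} ρ(x) ln(1+|x|²) dx is finite, one has −∫_{ℝ²}∫_{ℝ²} ln|x−y| ρ(y) ρ(x) dy dx ≤ (1/2) ‖ρ‖_{L¹} ∫_{ℝ²} ρ(x) ln( ρ(x)/‖ρ‖_{L¹} ) dx + C ‖ρ‖_{L¹}², where C does not depend on ρ. -/
open MeasureTheory Real

noncomputable section

def hh (t : ℝ) : ℝ := t ^ (-(3/2) : ℝ) * (max 1 t) ^ (-(3/2) : ℝ)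

lemma hh_nonneg {t : ℝ} (ht : 0 ≤ t) : 0 ≤ hh t := by unfold hh; positivity

lemma hh_int : Integrable (fun v : E2 => hh ‖v‖) := by
  rw [integrable_fun_norm_addHaar]
  have e : Set.Ioi (0:ℝ) = Set.Ioc 0 1 ∪ Set.Ioi 1 := by
    rw [Set.Ioc_union_Ioi_eq_Ioi zero_le_one]
  rw [e]
  refine IntegrableOn.union ?_ ?_
  · have h1 : IntegrableOn (fun x : ℝ => x ^ (-(1/2) : ℝ)) (Set.Ioc 0 1) := by
      have := intervalIntegral.intervalIntegrable_rpow' (a := 0) (b := 1) (r := -(1/2)) (by norm_num)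
      rwa [intervalIntegrable_iff_integrableOn_Ioc_of_le zero_le_one] at this
    refine h1.congr_fun (fun x hx => ?_) measurableSet_Ioc
    have hx0 : 0 < x := hx.1
    simp only [hh, finrank_euclideanSpace, Fintype.card_fin, max_eq_left hx.2, Real.one_rpow, mul_one, smul_eq_mul]
    rw [← Real.rpow_natCast, ← Real.rpow_add hx0]
    norm_num
  · have h1 : IntegrableOn (fun x : ℝ => x ^ (-2 : ℝ)) (Set.Ioi 1) :=
      integrableOn_Ioi_rpow_of_lt (by norm_num) zero_lt_one
    refine h1.congr_fun (fun x hx => ?_) measurableSet_Ioi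
    have hx1 : 1 < x := hx
    have hx0 : 0 < x := by linarith
    simp only [hh, finrank_euclideanSpace, Fintype.card_fin, max_eq_right hx1.le, smul_eq_mul]
    rw [← Real.rpow_natCast, ← Real.rpow_add hx0, ← Real.rpow_add hx0]
    norm_num

def KK (x y z : E2) : ℝ := ‖y - z‖ * ‖x - y‖ ^ (-(3/2) : ℝ) * ‖x - z‖ ^ (-(3/2) : ℝ)

lemma KK_nonneg (x y z : E2) : 0 ≤ KK x y z := by unfold KK; positivity

def cc : ℝ := ∫ v : E2, hh ‖v‖

lemma cc_nonneg : 0 ≤ cc := integral_nonneg fun v => hh_nonneg (norm_nonneg v)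

lemma aux {a b s : ℝ} (hs : 0 < s) (ha : 0 ≤ a) (hab : a ≤ b) (hb : s ≤ b) :
    2 * s * a ^ (-(3/2) : ℝ) * b ^ (-(3/2) : ℝ) ≤ 2 * (s ^ 2)⁻¹ * hh (s⁻¹ * a) := by
  have h1 : b ^ (-(3/2) : ℝ) ≤ (max s a) ^ (-(3/2) : ℝ) :=
    Real.rpow_le_rpow_of_nonpos (lt_max_of_lt_left hs) (max_le hb hab) (by norm_num)
  have h2 : max 1 (s⁻¹ * a) = s⁻¹ * max s a := by
    rw [mul_max_of_nonneg _ _ (inv_nonneg.2 hs.le), inv_mul_cancel₀ hs.ne']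
  have hm : 0 ≤ max s a := le_max_of_le_right ha
  have h3 : s = (s ^ 2)⁻¹ * ((s⁻¹) ^ (-(3/2) : ℝ) * (s⁻¹) ^ (-(3/2) : ℝ)) := by
    rw [← Real.rpow_add (inv_pos.2 hs), Real.inv_rpow hs.le, ← Real.rpow_neg hs.le]
    norm_num
    field_simp
  unfold hh
  rw [h2, Real.mul_rpow (inv_nonneg.2 hs.le) ha, Real.mul_rpow (inv_nonneg.2 hs.le) hm]
  calc _ ≤ 2 * s * a ^ (-(3/2) : ℝ) * (max s a) ^ (-(3/2) : ℝ) := by gcongr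
    _ = _ := by
      generalize (max s a) ^ (-(3/2) : ℝ) = u
      generalize a ^ (-(3/2) : ℝ) = v
      calc 2 * s * v * u = s * (2 * v * u) := by ring
        _ = ((s ^ 2)⁻¹ * ((s⁻¹) ^ (-(3/2) : ℝ) * (s⁻¹) ^ (-(3/2) : ℝ))) * (2 * v * u) := by rw [← h3]
        _ = _ := by ring

lemma KK_le {x y z : E2} (h : y ≠ z) : KK x y z ≤
    2 * ((‖y - z‖ / 2) ^ 2)⁻¹ * hh ‖(‖y - z‖ / 2)⁻¹ • (x - y)‖ +
    2 * ((‖y - z‖ / 2) ^ 2)⁻¹ * hh ‖(‖y - z‖ / 2)⁻¹ • (x - z)‖ := by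
  have hd : 0 < ‖y - z‖ := norm_pos_iff.2 (sub_ne_zero.2 h)
  have ht : ‖y - z‖ ≤ ‖x - y‖ + ‖x - z‖ := by
    have := norm_sub_le (x - z) (x - y)
    rw [show x - z - (x - y) = y - z by abel] at this
    linarith
  have hs : 0 < ‖y - z‖ / 2 := by linarith
  rw [norm_smul, norm_smul, norm_inv, Real.norm_of_nonneg hs.le]
  have n1 : 0 ≤ hh ((‖y - z‖ / 2)⁻¹ * ‖x - y‖) := hh_nonneg (by positivity)
  have n2 : 0 ≤ hh ((‖y - z‖ / 2)⁻¹ * ‖x - z‖) := hh_nonneg (by positivity)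
  rcases le_total ‖x - y‖ ‖x - z‖ with hh1 | hh1
  · have := aux hs (norm_nonneg (x - y)) hh1 (by linarith)
    have n3 : 0 ≤ 2 * ((‖y - z‖ / 2) ^ 2)⁻¹ * hh ((‖y - z‖ / 2)⁻¹ * ‖x - z‖) := by positivity
    have e : KK x y z = 2 * (‖y - z‖ / 2) * ‖x - y‖ ^ (-(3/2) : ℝ) * ‖x - z‖ ^ (-(3/2) : ℝ) := by
      unfold KK; ring
    linarith
  · have := aux hs (norm_nonneg (x - z)) hh1 (by linarith)
    have n3 : 0 ≤ 2 * ((‖y - z‖ / 2) ^ 2)⁻¹ * hh ((‖y - z‖ / 2)⁻¹ * ‖x - y‖) := by positivity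
    have e : KK x y z = 2 * (‖y - z‖ / 2) * ‖x - z‖ ^ (-(3/2) : ℝ) * ‖x - y‖ ^ (-(3/2) : ℝ) := by
      unfold KK; ring
    linarith

lemma scal {s : ℝ} (hs : 0 < s) (y : E2) :
    Integrable (fun x : E2 => 2 * (s ^ 2)⁻¹ * hh ‖s⁻¹ • (x - y)‖) ∧
    ∫ x : E2, 2 * (s ^ 2)⁻¹ * hh ‖s⁻¹ • (x - y)‖ = 2 * cc := by
  constructor
  · refine Integrable.const_mul ?_ _
    have := (hh_int.comp_smul (inv_ne_zero hs.ne')).comp_sub_right y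
    exact this
  · rw [integral_const_mul, integral_sub_right_eq_self (fun x : E2 => hh ‖s⁻¹ • x‖) y,
      Measure.integral_comp_smul volume (fun x : E2 => hh ‖x‖) s⁻¹]
    simp only [finrank_euclideanSpace, Fintype.card_fin, smul_eq_mul]
    rw [abs_of_nonneg (by positivity)]
    change _ * (_ * cc) = _
    field_simp

lemma KK_meas : Measurable (fun q : (E2 × E2) × E2 => KK q.2 q.1.1 q.1.2) := by
  unfold KK; fun_prop

lemma KK_int (y z : E2) : Integrable (fun x => KK x y z) ∧ ∫ x, KK x y z ≤ 4 * cc := by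
  by_cases h : y = z
  · subst h
    have : (fun x => KK x y y) = fun _ => (0:ℝ) := by funext x; simp [KK]
    rw [this]
    refine ⟨integrable_zero _ _ _, ?_⟩
    have := cc_nonneg
    simp; linarith
  · have hs : 0 < ‖y - z‖ / 2 := half_pos (norm_pos_iff.2 (sub_ne_zero.2 h))
    obtain ⟨i1, e1⟩ := scal hs y
    obtain ⟨i2, e2⟩ := scal hs z
    have i : Integrable (fun x => KK x y z) := by
      refine (i1.add i2).mono' ?_ (.of_forall fun x => ?_)
      · have hm : Measurable (fun x => KK x y z) := by unfold KK; fun_prop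
        exact hm.aestronglyMeasurable
      · rw [Real.norm_of_nonneg (KK_nonneg _ _ _)]
        exact KK_le h
    refine ⟨i, ?_⟩
    calc _ ≤ _ := integral_mono i (i1.add i2) (fun x => KK_le h)
      _ = 4 * cc := by
        have := integral_add i1 i2
        simp only [Pi.add_apply]
        rw [this, e1, e2]; ring

def sg (q : (E2 × E2) × E2) : (E2 × E2) × E2 := ((q.2, q.1.1), q.1.2)

lemma sg_mp : MeasurePreserving sg := by
  have h1 : MeasurePreserving (MeasurableEquiv.prodAssoc : (E2 × E2) × E2 ≃ᵐ _) :=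
    ⟨MeasurableEquiv.prodAssoc.measurable, Measure.prodAssoc_prod⟩
  exact (h1.symm _).comp Measure.measurePreserving_swap

lemma ne_ae : ∀ᵐ p : E2 × E2, p.1 ≠ p.2 := by
  rw [ae_iff]
  have hm : MeasurableSet {p : E2 × E2 | ¬ p.1 ≠ p.2} := by
    simp only [not_not]
    exact measurableSet_eq_fun measurable_fst measurable_snd
  refine (Measure.measure_prod_null hm).2 (.of_forall fun x => ?_)
  have : (Prod.mk x ⁻¹' {p : E2 × E2 | ¬ p.1 ≠ p.2}) = {x} := by
    ext y; simp [eq_comm]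
  simp

lemma pt {M a b c x y z : ℝ} (hM : 0 < M) (hx : 0 < x) (hy : 0 < y) (hz : 0 < z)
    (ha : 0 ≤ a) (hb : 0 ≤ b) (hc : 0 ≤ c) :
    (Real.log x * b * c) * a - 3/2 * ((Real.log y * a * b) * c) - 3/2 * ((Real.log z * c * a) * b)
      - (b * c) * (a * Real.log (a / M)) ≤ M * ((b * c) * (x * y ^ (-(3/2) : ℝ) * z ^ (-(3/2) : ℝ))) := by
  rcases ha.eq_or_lt with rfl | ha
  · simp; positivity
  · set k := x * y ^ (-(3/2) : ℝ) * z ^ (-(3/2) : ℝ) with hk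
    have hk0 : 0 < k := by positivity
    have hl : Real.log k = Real.log x - 3/2 * Real.log y - 3/2 * Real.log z := by
      rw [hk, Real.log_mul (by positivity) (by positivity), Real.log_mul (by positivity) (by positivity),
        Real.log_rpow hy, Real.log_rpow hz]; ring
    have h1 : Real.log k - Real.log (a / M) ≤ k * M / a := by
      rw [← Real.log_div hk0.ne' (by positivity)]
      have := Real.log_le_sub_one_of_pos (x := k / (a / M)) (by positivity)
      have e : k / (a / M) = k * M / a := by field_simp
      rw [e] at *
      linarith
    have h2 := mul_le_mul_of_nonneg_left h1 (show 0 ≤ a * b * c by positivity)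
    have h3 : a * b * c * (k * M / a) = M * (b * c * k) := by field_simp
    rw [h3, hl] at h2
    linarith

/-- Logarithmic Hardy–Littlewood–Sobolev inequality: there is a constant `C > 0` such that
for every a.e. non-negative `ρ ∈ L¹(ℝ²)`, not a.e. zero, with finite logarithmic moment
`∫ ρ ln(1+|x|²) dx < ∞`, one has
`-∫∫ ln|x-y| ρ(y) ρ(x) dy dx ≤ (1/2)‖ρ‖₁ ∫ ρ ln(ρ/‖ρ‖₁) + C ‖ρ‖₁²`
(here the entropy integral and the double integral are assumed to be well defined,
i.e. the corresponding integrands are integrable, and `‖ρ‖₁ = ∫ ρ` since `ρ ≥ 0`). -/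
theorem stmt6 :
    ∃ C > (0:ℝ), ∀ ρ : E2 → ℝ,
      Integrable ρ →
      (∀ᵐ x ∂(volume : Measure E2), 0 ≤ ρ x) →
      ¬(∀ᵐ x ∂(volume : Measure E2), ρ x = 0) →
      Integrable (fun x : E2 => ρ x * Real.log (1 + ‖x‖ ^ 2)) →
      Integrable (fun x : E2 => ρ x * Real.log (ρ x / ∫ x' : E2, ρ x')) →
      Integrable (fun z : E2 × E2 => Real.log ‖z.1 - z.2‖ * ρ z.1 * ρ z.2) →
      -∫ x : E2, ∫ y : E2, Real.log ‖x - y‖ * ρ y * ρ x ≤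
        (1/2) * (∫ x : E2, ρ x) * (∫ x : E2, ρ x * Real.log (ρ x / ∫ x' : E2, ρ x'))
          + C * (∫ x : E2, ρ x) ^ 2 := by
  refine ⟨2 * cc + 1, by have := cc_nonneg; linarith, ?_⟩
  intro ρ hρ h0 hne _ hent hL
  have hM : 0 < ∫ x, ρ x := by
    have := integral_nonneg_of_ae h0
    refine lt_of_le_of_ne this fun h => hne ?_
    exact (integral_eq_zero_iff_of_nonneg_ae h0 hρ).1 h.symm
  set M := ∫ x, ρ x with hMdef
  have hI : ∫ x : E2, ∫ y : E2, Real.log ‖x - y‖ * ρ y * ρ x =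
      ∫ z : E2 × E2, Real.log ‖z.1 - z.2‖ * ρ z.1 * ρ z.2 := by
    rw [Measure.volume_eq_prod, integral_prod _ hL]
    congr 1; funext x; congr 1; funext y; ring
  rw [hI]
  set I := ∫ z : E2 × E2, Real.log ‖z.1 - z.2‖ * ρ z.1 * ρ z.2 with hIdef
  set S := ∫ x, ρ x * Real.log (ρ x / M) with hS
  set T : (E2 × E2) × E2 → ℝ := fun q => (Real.log ‖q.1.1 - q.1.2‖ * ρ q.1.1 * ρ q.1.2) * ρ q.2 with hT
  have iT : Integrable T := hL.mul_prod hρ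
  have eT : ∫ q, T q = I * M := integral_prod_mul (fun z : E2 × E2 => Real.log ‖z.1 - z.2‖ * ρ z.1 * ρ z.2) ρ
  have iT1 : Integrable (fun q => T (sg q)) := sg_mp.integrable_comp_of_integrable iT
  have iT2 : Integrable (fun q => T (sg (sg q))) := sg_mp.integrable_comp_of_integrable iT1
  have key : ∀ f : (E2 × E2) × E2 → ℝ, Integrable f → ∫ q, f (sg q) = ∫ q, f q := by
    intro f hf
    have := integral_map (μ := volume) sg_mp.measurable.aemeasurable (f := f)
      (by rw [sg_mp.map_eq]; exact hf.aestronglyMeasurable)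
    rw [sg_mp.map_eq] at this
    exact this.symm
  have eT1 : ∫ q, T (sg q) = I * M := (key T iT).trans eT
  have eT2 : ∫ q, T (sg (sg q)) = I * M := (key _ iT1).trans eT1
  have iP : Integrable (fun p : E2 × E2 => ρ p.1 * ρ p.2) := hρ.mul_prod hρ
  have eP : ∫ p : E2 × E2, ρ p.1 * ρ p.2 = M * M := integral_prod_mul ρ ρ
  have iU : Integrable (fun q : (E2 × E2) × E2 => (ρ q.1.1 * ρ q.1.2) * (ρ q.2 * Real.log (ρ q.2 / M))) :=
    iP.mul_prod hent
  have eU : ∫ q : (E2 × E2) × E2, (ρ q.1.1 * ρ q.1.2) * (ρ q.2 * Real.log (ρ q.2 / M)) = M * M * S := by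
    rw [← eP]
    exact integral_prod_mul (fun p : E2 × E2 => ρ p.1 * ρ p.2) (fun x => ρ x * Real.log (ρ x / M))
  set G : (E2 × E2) × E2 → ℝ := fun q => (ρ q.1.1 * ρ q.1.2) * KK q.2 q.1.1 q.1.2 with hG
  have mG : AEStronglyMeasurable G ((volume : Measure (E2 × E2)).prod (volume : Measure E2)) :=
    iP.aestronglyMeasurable.comp_fst.mul KK_meas.aestronglyMeasurable
  have iG' : Integrable G ((volume : Measure (E2 × E2)).prod (volume : Measure E2)) := by
    rw [integrable_prod_iff mG]
    refine ⟨.of_forall fun p => (KK_int p.1 p.2).1.const_mul (ρ p.1 * ρ p.2), ?_⟩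
    refine (iP.norm.mul_const (4 * cc)).mono' mG.norm.integral_prod_right' (.of_forall fun p => ?_)
    rw [Real.norm_of_nonneg (integral_nonneg fun _ => norm_nonneg _)]
    simp only [hG, norm_mul (ρ p.1 * ρ p.2), integral_const_mul, Real.norm_of_nonneg (KK_nonneg _ _ _)]
    exact mul_le_mul_of_nonneg_left (KK_int p.1 p.2).2 (norm_nonneg _)
  have iG : Integrable G := iG'
  have h0P : ∀ᵐ p : E2 × E2, 0 ≤ ρ p.1 ∧ 0 ≤ ρ p.2 :=
    (Measure.quasiMeasurePreserving_fst.ae h0).and (Measure.quasiMeasurePreserving_snd.ae h0)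
  have eG : ∫ q, G q ≤ M * M * (4 * cc) := by
    have : ∫ q, G q = ∫ p : E2 × E2, ∫ x, G (p, x) := integral_prod _ iG'
    rw [this, ← eP, ← integral_mul_const]
    refine integral_mono_ae iG'.integral_prod_left (iP.mul_const _) ?_
    filter_upwards [h0P] with p hp
    simp only [hG, integral_const_mul]
    exact mul_le_mul_of_nonneg_left (KK_int p.1 p.2).2 (mul_nonneg hp.1 hp.2)
  have n0 : ∀ᵐ q : (E2 × E2) × E2, q.1.1 ≠ q.1.2 := Measure.quasiMeasurePreserving_fst.ae ne_ae
  have n1 : ∀ᵐ q : (E2 × E2) × E2, (sg q).1.1 ≠ (sg q).1.2 := sg_mp.quasiMeasurePreserving.ae n0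
  have n2 : ∀ᵐ q : (E2 × E2) × E2, (sg (sg q)).1.1 ≠ (sg (sg q)).1.2 := sg_mp.quasiMeasurePreserving.ae n1
  have p1 : ∀ᵐ q : (E2 × E2) × E2, 0 ≤ ρ q.1.1 ∧ 0 ≤ ρ q.1.2 := Measure.quasiMeasurePreserving_fst.ae h0P
  have p2 : ∀ᵐ q : (E2 × E2) × E2, 0 ≤ ρ q.2 := Measure.quasiMeasurePreserving_snd.ae h0
  have main := integral_mono_ae (((iT.sub (iT1.const_mul (3/2))).sub (iT2.const_mul (3/2))).sub iU)
    (iG.const_mul M) (by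
      filter_upwards [n0, n1, n2, p1, p2] with q n0 n1 n2 p1 p2
      have := pt hM (norm_pos_iff.2 (sub_ne_zero.2 n0)) (norm_pos_iff.2 (sub_ne_zero.2 n1))
        (norm_pos_iff.2 (sub_ne_zero.2 n2)) p2 p1.1 p1.2
      simp only [sg] at this
      simp only [hT, hG, sg, KK, Pi.sub_apply]
      rw [norm_sub_rev q.2 q.1.2]
      exact this)
  have e1 := integral_sub ((iT.sub (iT1.const_mul (3/2))).sub (iT2.const_mul (3/2))) iU
  have e2 := integral_sub (iT.sub (iT1.const_mul (3/2))) (iT2.const_mul (3/2))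
  have e3 := integral_sub iT (iT1.const_mul (3/2))
  simp only [Pi.sub_apply] at main e1 e2 e3
  rw [e1, e2, e3, integral_const_mul, integral_const_mul, integral_const_mul, eT, eT1, eT2, eU] at main
  have h4 := main.trans (mul_le_mul_of_nonneg_left eG hM.le)
  have h5 : M * (2 * -I) ≤ M * (M * S + 4 * cc * M ^ 2) := by linarith
  have h6 := le_of_mul_le_mul_left h5 hM
  nlinarith [sq_nonneg M]
end
end
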